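/- (Theorem 4.4-(4), Existence of a robust equilibrium.) Every MG-SPA (with finite state and action spaces, shared bounded reward, stationary transition kernel, bijective perturbation, and 0 ≤ γ < 1) admits a robust equilibrium in stationary mixed policies: there exist an agent policy π* : S → (B → stdSimplex ℝ A) and an adversary policy ρ* : S → stdSimplex ℝ B such that for every agent policy π, every adversary policy ρ, and every s ∈ S: v_{π,ρ*}(s) ≤ v_{π*,ρ*}(s) ≤ v_{π*,ρ}(s). -/

import Mathlib

open scoped BigOperators

section MGSPA

variable {S A B : Type*}

/-- The induced one-step expected reward of the joint policy `(π, ρ)`: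
`r_{π,ρ}(s) = ∑ b, (ρ s) b * ∑ a, (π s b) a * r s a b`. -/
noncomputable def rPol [Fintype A] [Fintype B]
    (r : S → A → B → ℝ)
    (π : S → B → stdSimplex ℝ A) (ρ : S → stdSimplex ℝ B) : S → ℝ :=
  fun s => ∑ b, (ρ s : B → ℝ) b * ∑ a, (π s b : A → ℝ) a * r s a b

/-- The induced state-transition matrix of the joint policy `(π, ρ)`:
`P_{π,ρ}(s, s') = ∑ b, (ρ s) b * ∑ a, (π s b) a * p s a b s'`. -/
noncomputable def PPol [Fintype A] [Fintype B]
    (p : S → A → B → S → ℝ)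
    (π : S → B → stdSimplex ℝ A) (ρ : S → stdSimplex ℝ B) : Matrix S S ℝ :=
  fun s s' => ∑ b, (ρ s : B → ℝ) b * ∑ a, (π s b : A → ℝ) a * p s a b s'

/-- The value function of the joint policy `(π, ρ)`:
`v_{π,ρ}(s) = ∑' t, γ^t * ((P_{π,ρ}^t) *ᵥ r_{π,ρ}) s`. -/
noncomputable def vFn [Fintype S] [DecidableEq S] [Fintype A] [Fintype B]
    (γ : ℝ) (r : S → A → B → ℝ) (p : S → A → B → S → ℝ)
    (π : S → B → stdSimplex ℝ A) (ρ : S → stdSimplex ℝ B) : S → ℝ :=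
  fun s => ∑' t : ℕ, γ ^ t * (((PPol p π ρ) ^ t).mulVec (rPol r π ρ)) s

/-- The minimax (Shapley) Bellman operator of the MG-SPA. -/
noncomputable def Lop [Fintype S] [Fintype A] [Fintype B]
    (γ : ℝ) (r : S → A → B → ℝ) (p : S → A → B → S → ℝ)
    (v : S → ℝ) : S → ℝ :=
  fun s => ⨆ x : B → stdSimplex ℝ A, ⨅ y : stdSimplex ℝ B,
    ∑ b, (y : B → ℝ) b * ∑ a, (x b : A → ℝ) a *
      (r s a b + γ * ∑ s', p s a b s' * v s')

end MGSPA

section Bellman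

variable {S A B : Type*} [Fintype S] [Fintype A] [Fintype B]

/-- The one-step lookahead value of the action pair `(a, b)` at `s` with continuation `v`. -/
def qFn (γ : ℝ) (r : S → A → B → ℝ) (p : S → A → B → S → ℝ) (v : S → ℝ)
    (s : S) (a : A) (b : B) : ℝ :=
  r s a b + γ * ∑ s', p s a b s' * v s'

lemma rPol_add_mulVec_PPol (γ : ℝ) (r : S → A → B → ℝ) (p : S → A → B → S → ℝ)
    (π : S → B → stdSimplex ℝ A) (ρ : S → stdSimplex ℝ B) (v : S → ℝ) (s : S) :
    rPol r π ρ s + γ * (PPol p π ρ).mulVec v s =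
      ∑ b, (ρ s : B → ℝ) b * ∑ a, (π s b : A → ℝ) a * qFn γ r p v s a b := by
  have h : (PPol p π ρ).mulVec v s =
      ∑ b, (ρ s : B → ℝ) b * ∑ a, (π s b : A → ℝ) a * ∑ s', p s a b s' * v s' := by
    simp only [Matrix.mulVec, dotProduct, PPol, Finset.sum_mul, Finset.mul_sum]
    rw [Finset.sum_comm]
    refine Finset.sum_congr rfl fun b _ => ?_
    rw [Finset.sum_comm]
    exact Finset.sum_congr rfl fun a _ => Finset.sum_congr rfl fun s' _ => by ring
  rw [h, rPol, Finset.mul_sum, ← Finset.sum_add_distrib]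
  refine Finset.sum_congr rfl fun b _ => ?_
  rw [mul_left_comm, ← mul_add, Finset.mul_sum, ← Finset.sum_add_distrib]
  congr 1
  exact Finset.sum_congr rfl fun a _ => by rw [qFn]; ring

lemma sum_vertex_mul {X : Type*} [Fintype X] [DecidableEq X] (i : X) (f : X → ℝ) :
    ∑ j, (stdSimplex.vertex i : stdSimplex ℝ X) j * f j = f i := by
  change ∑ j, (Pi.single i 1 : X → ℝ) j * f j = f i
  simp [Pi.single_apply]

lemma sum_stdSimplex_mul_le {X : Type*} [Fintype X] (x : stdSimplex ℝ X) {f : X → ℝ} {c : ℝ}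
    (h : ∀ i, f i ≤ c) : ∑ i, (x : X → ℝ) i * f i ≤ c :=
  calc ∑ i, (x : X → ℝ) i * f i ≤ ∑ i, (x : X → ℝ) i * c :=
        Finset.sum_le_sum fun i _ => mul_le_mul_of_nonneg_left (h i) (x.2.1 i)
    _ = c := by rw [← Finset.sum_mul, stdSimplex.sum_eq_one, one_mul]

lemma le_sum_stdSimplex_mul {X : Type*} [Fintype X] (x : stdSimplex ℝ X) {f : X → ℝ} {c : ℝ}
    (h : ∀ i, c ≤ f i) : c ≤ ∑ i, (x : X → ℝ) i * f i :=
  calc c = ∑ i, (x : X → ℝ) i * c := by rw [← Finset.sum_mul, stdSimplex.sum_eq_one, one_mul]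
    _ ≤ _ := Finset.sum_le_sum fun i _ => mul_le_mul_of_nonneg_left (h i) (x.2.1 i)

lemma PPol_mem_rowStochastic [DecidableEq S] {p : S → A → B → S → ℝ}
    (hp0 : ∀ s a b s', 0 ≤ p s a b s') (hp1 : ∀ s a b, ∑ s', p s a b s' = 1)
    (π : S → B → stdSimplex ℝ A) (ρ : S → stdSimplex ℝ B) :
    PPol p π ρ ∈ Matrix.rowStochastic ℝ S := by
  rw [Matrix.mem_rowStochastic]
  refine ⟨fun s s' => Finset.sum_nonneg fun b _ => mul_nonneg ((ρ s).2.1 b)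
    (Finset.sum_nonneg fun a _ => mul_nonneg ((π s b).2.1 a) (hp0 s a b s')), ?_⟩
  ext s
  have h := rPol_add_mulVec_PPol 1 0 p π ρ 1 s
  simpa [rPol, qFn, hp1, (ρ s).2.2, (π s _).2.2] using h

lemma mulVec_le_of_rowStochastic [DecidableEq S] {P : Matrix S S ℝ}
    (hP : P ∈ Matrix.rowStochastic ℝ S) {v : S → ℝ} {c : ℝ} (h : ∀ s, v s ≤ c) (s : S) :
    P.mulVec v s ≤ c :=
  sum_stdSimplex_mul_le ⟨P s, fun s' => hP.1 s s', Matrix.sum_row_of_mem_rowStochastic hP s⟩ h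

lemma le_mulVec_of_rowStochastic [DecidableEq S] {P : Matrix S S ℝ}
    (hP : P ∈ Matrix.rowStochastic ℝ S) {v : S → ℝ} {c : ℝ} (h : ∀ s, c ≤ v s) (s : S) :
    c ≤ P.mulVec v s :=
  le_sum_stdSimplex_mul ⟨P s, fun s' => hP.1 s s', Matrix.sum_row_of_mem_rowStochastic hP s⟩ h

lemma summable_discounted_mulVec [DecidableEq S] {γ : ℝ} (hγ0 : 0 ≤ γ) (hγ1 : γ < 1)
    {P : Matrix S S ℝ} (hP : P ∈ Matrix.rowStochastic ℝ S) (v : S → ℝ) (s : S) :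
    Summable fun t : ℕ => γ ^ t * (P ^ t).mulVec v s := by
  refine Summable.of_norm_bounded ((summable_geometric_of_lt_one hγ0 hγ1).mul_right ‖v‖)
    fun t => ?_
  have hPt : P ^ t ∈ Matrix.rowStochastic ℝ S := pow_mem hP t
  rw [norm_mul, Real.norm_of_nonneg (pow_nonneg hγ0 t)]
  refine mul_le_mul_of_nonneg_left (abs_le.2 ⟨?_, ?_⟩) (pow_nonneg hγ0 t)
  · exact le_mulVec_of_rowStochastic hPt (fun i => (abs_le.1 (norm_le_pi_norm v i)).1) s
  · exact mulVec_le_of_rowStochastic hPt (fun i => (abs_le.1 (norm_le_pi_norm v i)).2) s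

lemma vFn_eq_rPol_add [DecidableEq S] {γ : ℝ} (hγ0 : 0 ≤ γ) (hγ1 : γ < 1)
    (r : S → A → B → ℝ) {p : S → A → B → S → ℝ}
    (hp0 : ∀ s a b s', 0 ≤ p s a b s') (hp1 : ∀ s a b, ∑ s', p s a b s' = 1)
    (π : S → B → stdSimplex ℝ A) (ρ : S → stdSimplex ℝ B) (s : S) :
    vFn γ r p π ρ s = rPol r π ρ s + γ * (PPol p π ρ).mulVec (vFn γ r p π ρ) s := by
  have hsum := summable_discounted_mulVec hγ0 hγ1 (PPol_mem_rowStochastic hp0 hp1 π ρ)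
    (rPol r π ρ)
  have hP : (PPol p π ρ).mulVec (vFn γ r p π ρ) s =
      ∑' t : ℕ, ∑ s', PPol p π ρ s s' *
        (γ ^ t * ((PPol p π ρ) ^ t).mulVec (rPol r π ρ) s') := by
    rw [Summable.tsum_finsetSum fun s' _ => (hsum s').mul_left _]
    exact Finset.sum_congr rfl fun s' _ => (tsum_mul_left).symm
  rw [vFn, (hsum s).tsum_eq_zero_add, hP, ← tsum_mul_left]
  congr 1
  · simp
  · refine tsum_congr fun t => ?_
    rw [pow_succ' (PPol p π ρ), ← Matrix.mulVec_mulVec]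
    generalize ((PPol p π ρ) ^ t).mulVec (rPol r π ρ) = w
    simp only [Matrix.mulVec, dotProduct, Finset.mul_sum]
    exact Finset.sum_congr rfl fun s' _ => by ring

/-- Maximum principle for a discounted stochastic matrix. -/
lemma nonpos_of_le_discounted_mulVec [DecidableEq S] [Nonempty S] {γ : ℝ} (hγ0 : 0 ≤ γ)
    (hγ1 : γ < 1) {P : Matrix S S ℝ} (hP : P ∈ Matrix.rowStochastic ℝ S) {w : S → ℝ}
    (h : ∀ s, w s ≤ γ * P.mulVec w s) (s : S) : w s ≤ 0 := by
  obtain ⟨m, hm⟩ := Finite.exists_max w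
  have h1 : w m ≤ γ * w m :=
    (h m).trans (mul_le_mul_of_nonneg_left (mulVec_le_of_rowStochastic hP hm m) hγ0)
  have h2 : w m ≤ 0 := by nlinarith
  exact (hm s).trans h2

lemma vFn_le_of_lookahead_le [DecidableEq S] [Nonempty S] {γ : ℝ} (hγ0 : 0 ≤ γ) (hγ1 : γ < 1)
    {r : S → A → B → ℝ} {p : S → A → B → S → ℝ}
    (hp0 : ∀ s a b s', 0 ≤ p s a b s') (hp1 : ∀ s a b, ∑ s', p s a b s' = 1)
    {π : S → B → stdSimplex ℝ A} {ρ : S → stdSimplex ℝ B} {v : S → ℝ}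
    (h : ∀ s, rPol r π ρ s + γ * (PPol p π ρ).mulVec v s ≤ v s) (s : S) :
    vFn γ r p π ρ s ≤ v s := by
  refine sub_nonpos.1 (nonpos_of_le_discounted_mulVec hγ0 hγ1
    (PPol_mem_rowStochastic hp0 hp1 π ρ) (w := vFn γ r p π ρ - v) (fun s => ?_) s)
  rw [Matrix.mulVec_sub, Pi.sub_apply, Pi.sub_apply]
  linarith [h s, vFn_eq_rPol_add hγ0 hγ1 r hp0 hp1 π ρ s]

lemma le_vFn_of_le_lookahead [DecidableEq S] [Nonempty S] {γ : ℝ} (hγ0 : 0 ≤ γ) (hγ1 : γ < 1)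
    {r : S → A → B → ℝ} {p : S → A → B → S → ℝ}
    (hp0 : ∀ s a b s', 0 ≤ p s a b s') (hp1 : ∀ s a b, ∑ s', p s a b s' = 1)
    {π : S → B → stdSimplex ℝ A} {ρ : S → stdSimplex ℝ B} {v : S → ℝ}
    (h : ∀ s, v s ≤ rPol r π ρ s + γ * (PPol p π ρ).mulVec v s) (s : S) :
    v s ≤ vFn γ r p π ρ s := by
  refine sub_nonpos.1 (nonpos_of_le_discounted_mulVec hγ0 hγ1
    (PPol_mem_rowStochastic hp0 hp1 π ρ) (w := v - vFn γ r p π ρ) (fun s => ?_) s)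
  rw [Matrix.mulVec_sub, Pi.sub_apply, Pi.sub_apply]
  linarith [h s, vFn_eq_rPol_add hγ0 hγ1 r hp0 hp1 π ρ s]

/-- The Bellman operator in which the agent best-responds to the adversary's action. -/
noncomputable def minMaxOp [Nonempty A] [Nonempty B] (γ : ℝ) (r : S → A → B → ℝ)
    (p : S → A → B → S → ℝ) (v : S → ℝ) (s : S) : ℝ :=
  Finset.univ.inf' Finset.univ_nonempty fun b =>
    Finset.univ.sup' Finset.univ_nonempty fun a => qFn γ r p v s a b

omit [Fintype A] [Fintype B] in
lemma qFn_le_add_dist {γ : ℝ} (hγ0 : 0 ≤ γ) (r : S → A → B → ℝ) {p : S → A → B → S → ℝ}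
    (hp0 : ∀ s a b s', 0 ≤ p s a b s') (hp1 : ∀ s a b, ∑ s', p s a b s' = 1)
    (v w : S → ℝ) (s : S) (a : A) (b : B) :
    qFn γ r p v s a b ≤ qFn γ r p w s a b + γ * dist v w := by
  have h : ∑ s', p s a b s' * (v s' - w s') ≤ dist v w :=
    sum_stdSimplex_mul_le ⟨p s a b, hp0 s a b, hp1 s a b⟩ fun s' =>
      (le_abs_self _).trans (dist_le_pi_dist v w s')
  simp only [mul_sub, Finset.sum_sub_distrib] at h
  have := mul_le_mul_of_nonneg_left h hγ0
  simp only [qFn]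
  linarith

lemma minMaxOp_le_add_dist [Nonempty A] [Nonempty B] {γ : ℝ} (hγ0 : 0 ≤ γ)
    (r : S → A → B → ℝ) {p : S → A → B → S → ℝ}
    (hp0 : ∀ s a b s', 0 ≤ p s a b s') (hp1 : ∀ s a b, ∑ s', p s a b s' = 1)
    (v w : S → ℝ) (s : S) :
    minMaxOp γ r p v s ≤ minMaxOp γ r p w s + γ * dist v w := by
  rw [← sub_le_iff_le_add]
  refine Finset.le_inf' _ _ fun b hb => ?_
  rw [sub_le_iff_le_add]
  refine (Finset.inf'_le _ hb).trans (Finset.sup'_le _ _ fun a ha => ?_)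
  exact (qFn_le_add_dist hγ0 r hp0 hp1 v w s a b).trans
    (add_le_add_left (Finset.le_sup' (fun a => qFn γ r p w s a b) ha) _)

lemma exists_minMaxOp_eq_self [Nonempty A] [Nonempty B] {γ : ℝ} (hγ0 : 0 ≤ γ) (hγ1 : γ < 1)
    (r : S → A → B → ℝ) {p : S → A → B → S → ℝ}
    (hp0 : ∀ s a b s', 0 ≤ p s a b s') (hp1 : ∀ s a b, ∑ s', p s a b s' = 1) :
    ∃ v : S → ℝ, minMaxOp γ r p v = v := by
  have hT : ContractingWith ⟨γ, hγ0⟩ (minMaxOp γ r p) := by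
    refine ⟨hγ1, LipschitzWith.of_dist_le_mul fun v w => ?_⟩
    refine (dist_pi_le_iff (mul_nonneg hγ0 dist_nonneg)).2 fun s => abs_sub_le_iff.2 ⟨?_, ?_⟩
    · exact sub_le_iff_le_add'.2 (minMaxOp_le_add_dist hγ0 r hp0 hp1 v w s)
    · rw [dist_comm]
      exact sub_le_iff_le_add'.2 (minMaxOp_le_add_dist hγ0 r hp0 hp1 w v s)
  exact ⟨_, hT.fixedPoint_isFixedPt⟩

end Bellman

/-- (Theorem 4.4-(4), Existence of a robust equilibrium.)  Every MG-SPA with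
finite state and action spaces, shared reward, stationary transition kernel
and discount `0 ≤ γ < 1` admits a robust equilibrium in stationary mixed
policies. -/
theorem robust_equilibrium_exists
    {S A B : Type*} [Fintype S] [DecidableEq S] [Nonempty S]
    [Fintype A] [Nonempty A] [Fintype B] [Nonempty B]
    (γ : ℝ) (hγ0 : 0 ≤ γ) (hγ1 : γ < 1)
    (r : S → A → B → ℝ) (p : S → A → B → S → ℝ)
    (hp0 : ∀ s a b s', 0 ≤ p s a b s')
    (hp1 : ∀ s a b, ∑ s', p s a b s' = 1) :
    ∃ (πstar : S → B → stdSimplex ℝ A) (ρstar : S → stdSimplex ℝ B),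
      ∀ (π : S → B → stdSimplex ℝ A) (ρ : S → stdSimplex ℝ B) (s : S),
        vFn γ r p π ρstar s ≤ vFn γ r p πstar ρstar s ∧
        vFn γ r p πstar ρstar s ≤ vFn γ r p πstar ρ s := by
  classical
  obtain ⟨v, hv⟩ := exists_minMaxOp_eq_self hγ0 hγ1 r hp0 hp1
  choose aOpt haOpt using fun s b => Finite.exists_max fun a => qFn γ r p v s a b
  choose bOpt hbOpt using fun s => Finite.exists_min fun b => qFn γ r p v s (aOpt s b) b
  have hvalue : ∀ s, v s = qFn γ r p v s (aOpt s (bOpt s)) (bOpt s) := by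
    intro s
    have hsup : ∀ b, (Finset.univ.sup' Finset.univ_nonempty fun a => qFn γ r p v s a b) =
        qFn γ r p v s (aOpt s b) b := fun b =>
      le_antisymm (Finset.sup'_le _ _ fun a _ => haOpt s b a)
        (Finset.le_sup' (fun a => qFn γ r p v s a b) (Finset.mem_univ _))
    conv_lhs => rw [← hv]
    simp only [minMaxOp, hsup]
    exact le_antisymm
      (Finset.inf'_le (fun b => qFn γ r p v s (aOpt s b) b) (Finset.mem_univ _))
      (Finset.le_inf' _ _ fun b _ => hbOpt s b)
  let πstar : S → B → stdSimplex ℝ A := fun s b => stdSimplex.vertex (aOpt s b)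
  let ρstar : S → stdSimplex ℝ B := fun s => stdSimplex.vertex (bOpt s)
  have upper : ∀ π s, vFn γ r p π ρstar s ≤ v s := fun π =>
    vFn_le_of_lookahead_le hγ0 hγ1 hp0 hp1 fun s => by
      rw [rPol_add_mulVec_PPol, hvalue s]
      simp only [ρstar, sum_vertex_mul]
      exact sum_stdSimplex_mul_le _ fun a => haOpt s (bOpt s) a
  have lower : ∀ ρ s, v s ≤ vFn γ r p πstar ρ s := fun ρ =>
    le_vFn_of_le_lookahead hγ0 hγ1 hp0 hp1 fun s => by
      rw [rPol_add_mulVec_PPol, hvalue s]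
      simp only [πstar, sum_vertex_mul]
      exact le_sum_stdSimplex_mul _ fun b => hbOpt s b
  exact ⟨πstar, ρstar, fun π ρ s =>
    ⟨(upper π s).trans (lower ρstar s), (upper πstar s).trans (lower ρ s)⟩⟩
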